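/- Let λ = (λ_1 ≥ λ_2 ≥ ⋯ ≥ λ_r > 0) be a partition of length r ≤ d, and set λ_i := 0 for r < i ≤ d. Then in ℚ(y_1,…,y_d): Σ_{w∈C(r,d)} w·( ∏_{i=1}^{r} y_i^{λ_i−i+d} / ∏_{i=1}^{r} ∏_{j=i+1}^{d} (y_i − y_j) ) = det( y_j^{λ_i+d−i} )_{1≤i,j≤d} / det( y_j^{d−i} )_{1≤i,j≤d}; that is, the partial (coset) symmetrization on the left equals the Schur polynomial s_λ(y_1,…,y_d) given by the bialternant formula. -/

import Mathlib

open Finset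

noncomputable section

/-- The field `ℚ(y_1, …, y_d)` of rational functions. -/
abbrev K (d : ℕ) : Type := FractionRing (MvPolynomial (Fin d) ℚ)

/-- The indeterminate `y_i` (`0`-indexed). -/
def y (d : ℕ) (i : Fin d) : K d :=
  algebraMap (MvPolynomial (Fin d) ℚ) (K d) (MvPolynomial.X i)

/-- The coset representatives `C(r,d)`: permutations `w` of `{0, …, d-1}` that are
strictly increasing on positions `r, r+1, …, d-1` (`0`-indexed). -/
def Cperm (r d : ℕ) : Finset (Equiv.Perm (Fin d)) :=
  Finset.univ.filter fun w => ∀ i j : Fin d, r ≤ (i : ℕ) → i < j → w i < w j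

/-- The Vandermonde determinant with decreasing exponents, as a product of differences. -/
theorem det_pow_rev_eq_prod_sub {R : Type*} [CommRing R] (n : ℕ) (z : Fin n → R) :
    Matrix.det (Matrix.of fun i j : Fin n => z j ^ (n - 1 - (i : ℕ))) =
      ∏ i, ∏ j ∈ Finset.Ioi i, (z i - z j) := by
  have h := Matrix.det_projVandermonde (fun _ : Fin n => (1 : R)) z
  simp only [one_mul] at h
  rw [← h, ← Matrix.det_transpose]
  congr 1
  ext i j
  simp only [Matrix.transpose_apply, Matrix.of_apply, Matrix.projVandermonde_apply, one_pow,
    one_mul, Fin.val_rev]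
  congr 1
  omega

/-- The Leibniz expansion of a generalized alternant. -/
theorem det_pow_eq_sum_perm {R : Type*} [CommRing R] {n : ℕ} (z : Fin n → R) (b : Fin n → ℕ) :
    Matrix.det (Matrix.of fun i j : Fin n => z j ^ b i) =
      ∑ σ : Equiv.Perm (Fin n), ((Equiv.Perm.sign σ : ℤ) : R) * ∏ i, z (σ i) ^ b i := by
  rw [← Matrix.det_transpose, Matrix.det_apply']
  rfl

/-- A permutation of the last `m` positions, extended by the identity on the first `r`. -/
def permNatAdd (r : ℕ) {m : ℕ} (u : Equiv.Perm (Fin m)) : Equiv.Perm (Fin (r + m)) :=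
  finSumFinEquiv.permCongr (Equiv.Perm.sumCongr 1 u)

theorem permNatAdd_castAdd {r m : ℕ} (u : Equiv.Perm (Fin m)) (i : Fin r) :
    permNatAdd r u (Fin.castAdd m i) = Fin.castAdd m i := by
  simp [permNatAdd, Equiv.permCongr_apply]

theorem permNatAdd_natAdd {r m : ℕ} (u : Equiv.Perm (Fin m)) (j : Fin m) :
    permNatAdd r u (Fin.natAdd r j) = Fin.natAdd r (u j) := by
  simp [permNatAdd, Equiv.permCongr_apply]

theorem sign_permNatAdd {r m : ℕ} (u : Equiv.Perm (Fin m)) :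
    Equiv.Perm.sign (permNatAdd r u) = Equiv.Perm.sign u := by
  simp [permNatAdd, Equiv.Perm.sign_permCongr, Equiv.Perm.sign_sumCongr]

theorem mem_Cperm_add_iff {r m : ℕ} {w : Equiv.Perm (Fin (r + m))} :
    w ∈ Cperm r (r + m) ↔ StrictMono (w ∘ Fin.natAdd r) := by
  simp only [Cperm, Finset.mem_filter, Finset.mem_univ, true_and]
  constructor
  · intro h i j hij
    exact h _ _ (by simp) (by simpa using hij)
  · intro h i j hi hij
    have hi' : Fin.natAdd r (⟨i - r, by omega⟩ : Fin m) = i := Fin.ext (by simp; omega)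
    have hj' : Fin.natAdd r (⟨j - r, by omega⟩ : Fin m) = j := Fin.ext (by simp; omega)
    rw [← hi', ← hj']
    exact h (by simp only [Fin.lt_def]; omega)

/-- The permutations in `Cperm` represent the cosets of the group of permutations of the last `m`
positions. -/
theorem sum_Cperm_sum_permNatAdd {M : Type*} [AddCommMonoid M] {r m : ℕ}
    (f : Equiv.Perm (Fin (r + m)) → M) :
    ∑ w ∈ Cperm r (r + m), ∑ u : Equiv.Perm (Fin m), f (w * permNatAdd r u) = ∑ σ, f σ := by
  rw [← Finset.sum_product']
  refine Finset.sum_bij (fun p _ => p.1 * permNatAdd r p.2) (fun _ _ => Finset.mem_univ _)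
    ?_ ?_ (fun _ _ => rfl)
  · rintro ⟨w, u⟩ hw ⟨w', u'⟩ hw' h
    simp only [Finset.mem_product, Finset.mem_univ, and_true, mem_Cperm_add_iff] at hw hw'
    have head (i : Fin r) : w (Fin.castAdd m i) = w' (Fin.castAdd m i) := by
      simpa [permNatAdd_castAdd] using Equiv.congr_fun h (Fin.castAdd m i)
    have tail (j : Fin m) : w (Fin.natAdd r (u j)) = w' (Fin.natAdd r (u' j)) := by
      simpa [permNatAdd_natAdd] using Equiv.congr_fun h (Fin.natAdd r j)
    have hrange : Set.range (w ∘ Fin.natAdd r) = Set.range (w' ∘ Fin.natAdd r) := by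
      rw [← u.surjective.range_comp (w ∘ Fin.natAdd r),
        ← u'.surjective.range_comp (w' ∘ Fin.natAdd r)]
      exact congrArg Set.range (funext tail)
    have htail : w ∘ Fin.natAdd r = w' ∘ Fin.natAdd r := (hw.range_inj hw').1 hrange
    have hww : w = w' := by
      ext k
      induction k using Fin.addCases with
      | left i => rw [head]
      | right j => exact congrArg Fin.val (congrFun htail j)
    subst hww
    have huu : u = u' := Equiv.ext fun j => by simpa using tail j
    rw [huu]
  · intro σ _
    set s := Tuple.sort (σ ∘ Fin.natAdd r)
    refine ⟨(σ * permNatAdd r s, s⁻¹), ?_, ?_⟩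
    · simp only [Finset.mem_product, Finset.mem_univ, and_true, mem_Cperm_add_iff]
      have hcomp : (σ * permNatAdd r s) ∘ Fin.natAdd r = (σ ∘ Fin.natAdd r) ∘ s := by
        ext j
        simp [permNatAdd_natAdd]
      refine Monotone.strictMono_of_injective ?_
        ((σ * permNatAdd r s).injective.comp (Fin.natAdd_injective m r))
      rw [hcomp]
      exact Tuple.monotone_sort _
    · ext k
      induction k using Fin.addCases with
      | left i => simp [permNatAdd_castAdd]
      | right j => simp [permNatAdd_natAdd]

/-- The product of all differences splits according to whether the smaller index is among the
first `r` or the last `m`. -/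
theorem prod_sub_add {R : Type*} [CommRing R] {r m : ℕ} (z : Fin (r + m) → R) :
    ∏ i, ∏ j ∈ Finset.Ioi i, (z i - z j) =
      (∏ i : Fin r, ∏ j ∈ Finset.Ioi (Fin.castAdd m i), (z (Fin.castAdd m i) - z j)) *
        ∏ i : Fin m, ∏ j ∈ Finset.Ioi i, (z (Fin.natAdd r i) - z (Fin.natAdd r j)) := by
  rw [Fin.prod_univ_add]
  congr 1
  refine Finset.prod_congr rfl fun i _ => ?_
  have hI : Finset.Ioi (Fin.natAdd r i) = (Finset.Ioi i).map (Fin.natAddEmb r) := by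
    ext k
    induction k using Fin.addCases with
    | left l =>
      simp only [Finset.mem_Ioi, Finset.mem_map, Fin.natAddEmb_apply, Fin.lt_def, Fin.ext_iff,
        Fin.val_natAdd, Fin.val_castAdd]
      constructor
      · intro h; omega
      · rintro ⟨a, -, h⟩; omega
    | right l => simp
  rw [hI, Finset.prod_map]
  rfl

theorem prod_sub_perm {R : Type*} [CommRing R] {n : ℕ} (z : Fin n → R)
    (w : Equiv.Perm (Fin n)) :
    ∏ i, ∏ j ∈ Finset.Ioi i, (z (w i) - z (w j)) =
      ((Equiv.Perm.sign w : ℤ) : R) * ∏ i, ∏ j ∈ Finset.Ioi i, (z i - z j) := by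
  rw [← det_pow_rev_eq_prod_sub n z, ← det_pow_rev_eq_prod_sub n fun i => z (w i),
    ← Matrix.det_permute']
  rfl

/-- Coset symmetrization at distinct elements of a field, for arbitrary leading exponents. -/
theorem sum_Cperm_div_eq_det_div {F : Type*} [Field F] {r m : ℕ} (z : Fin (r + m) → F)
    (hz : Function.Injective z) (a : Fin r → ℕ) :
    (∑ w ∈ Cperm r (r + m),
      (∏ i : Fin r, z (w (Fin.castAdd m i)) ^ a i) /
      (∏ i : Fin r, ∏ j ∈ Finset.Ioi (Fin.castAdd m i), (z (w (Fin.castAdd m i)) - z (w j)))) =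
    Matrix.det (Matrix.of fun i j : Fin (r + m) =>
        z j ^ (Fin.append a (fun k : Fin m => m - 1 - (k : ℕ)) i)) /
    Matrix.det (Matrix.of fun i j : Fin (r + m) => z j ^ (r + m - 1 - (i : ℕ))) := by
  have hsub {i j : Fin (r + m)} (h : i < j) (w : Equiv.Perm (Fin (r + m))) :
      z (w i) - z (w j) ≠ 0 :=
    sub_ne_zero.2 fun e => h.ne (w.injective (hz e))
  rw [det_pow_rev_eq_prod_sub, det_pow_eq_sum_perm, eq_div_iff, Finset.sum_mul,
    ← sum_Cperm_sum_permNatAdd]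
  · refine Finset.sum_congr rfl fun w _ => ?_
    have hne : (∏ i : Fin r, ∏ j ∈ Finset.Ioi (Fin.castAdd m i),
        (z (w (Fin.castAdd m i)) - z (w j))) ≠ 0 :=
      Finset.prod_ne_zero_iff.2 fun i _ => Finset.prod_ne_zero_iff.2 fun j hj =>
        hsub (Finset.mem_Ioi.1 hj) w
    have hsq : ((Equiv.Perm.sign w : ℤ) : F) * ((Equiv.Perm.sign w : ℤ) : F) = 1 := by
      rw [← Int.cast_mul, ← Units.val_mul, Int.units_mul_self]
      simp
    have hV : ∏ i, ∏ j ∈ Finset.Ioi i, (z i - z j) = ((Equiv.Perm.sign w : ℤ) : F) *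
        ∏ i, ∏ j ∈ Finset.Ioi i, (z (w i) - z (w j)) := by
      rw [prod_sub_perm, ← mul_assoc, hsq, one_mul]
    have htail := (det_pow_rev_eq_prod_sub m fun j => z (w (Fin.natAdd r j))).symm.trans
      (det_pow_eq_sum_perm _ _)
    rw [hV, prod_sub_add fun i => z (w i), htail, div_mul_eq_mul_div, div_eq_iff hne]
    simp only [Equiv.Perm.sign_mul, sign_permNatAdd, Fin.prod_univ_add, Equiv.Perm.mul_apply,
      permNatAdd_castAdd, permNatAdd_natAdd, Fin.append_left, Fin.append_right,
      Units.val_mul, Int.cast_mul, Finset.mul_sum, Finset.sum_mul]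
    refine Finset.sum_congr rfl fun u _ => ?_
    ring
  · exact Finset.prod_ne_zero_iff.2 fun i _ => Finset.prod_ne_zero_iff.2 fun j hj =>
      hsub (Finset.mem_Ioi.1 hj) 1

theorem y_injective (d : ℕ) : Function.Injective (y d) :=
  (IsFractionRing.injective (MvPolynomial (Fin d) ℚ) (K d)).comp MvPolynomial.X_injective

/-- **The partial (coset) symmetrization equals the bialternant Schur polynomial.**

For a partition `λ_1 ≥ ⋯ ≥ λ_r > 0` of length `r ≤ d` (extended by zeros to length `d`),
`Σ_{w ∈ C(r,d)} w·( ∏_{i=1}^r y_i^{λ_i−i+d} / ∏_{i=1}^r ∏_{j=i+1}^d (y_i − y_j) )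
  = det( y_j^{λ_i+d−i} ) / det( y_j^{d−i} )`. -/
theorem coset_symmetrization_eq_schur_bialternant
    (d r : ℕ) (hr : 1 ≤ r) (hrd : r ≤ d)
    (lam : Fin r → ℕ) (hpos : ∀ i, 0 < lam i)
    (hanti : ∀ i j : Fin r, i ≤ j → lam j ≤ lam i) :
    (∑ w ∈ Cperm r d,
      (∏ i : Fin r, y d (w (Fin.castLE hrd i)) ^ (lam i + (d - 1 - (i : ℕ)))) /
      (∏ i : Fin r, ∏ j ∈ Finset.Ioi (Fin.castLE hrd i),
          (y d (w (Fin.castLE hrd i)) - y d (w j))))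
    =
    Matrix.det (Matrix.of fun i j : Fin d =>
        y d j ^ ((if h : (i : ℕ) < r then lam ⟨i, h⟩ else 0) + (d - 1 - (i : ℕ)))) /
    Matrix.det (Matrix.of fun i j : Fin d => y d j ^ (d - 1 - (i : ℕ))) := by
  obtain ⟨m, rfl⟩ := Nat.exists_eq_add_of_le hrd
  have hexp : (fun i : Fin (r + m) =>
      (if h : (i : ℕ) < r then lam ⟨i, h⟩ else 0) + (r + m - 1 - (i : ℕ))) =
      Fin.append (fun i : Fin r => lam i + (r + m - 1 - (i : ℕ)))
        (fun k : Fin m => m - 1 - (k : ℕ)) := by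
    funext i
    induction i using Fin.addCases with
    | left i => simp
    | right k =>
      simp only [Fin.append_right, Fin.val_natAdd, not_lt.2 (Nat.le_add_right r (k : ℕ)),
        dite_false]
      omega
  have h := sum_Cperm_div_eq_det_div (y (r + m)) (y_injective _)
    fun i : Fin r => lam i + (r + m - 1 - (i : ℕ))
  rw [← hexp] at h
  exact h
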